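/- arXiv:2002.02388 — 2 statements merged into one kernel-verified Lean document; each statement's English description precedes it below -/
import Mathlib

section
/- For any two groups G and H, corank(G * H) = corank(G) + corank(H), where G * H denotes the free product, provided G and H are finitely generated. -/
/-- The corank of a group `G`: the largest `r` such that there is an epimorphism of `G`
onto the free group of rank `r`. -/
noncomputable def corank (G : Type*) [Group G] : ℕ :=
  sSup {r : ℕ | ∃ φ : G →* FreeGroup (Fin r), Function.Surjective φ}

/-- A free group generated by finitely many elements has finite rank, bounded by their number. -/
theorem FreeGroup.finite_and_card_le_of_surjective {α β : Type*} [Finite α]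
    (f : FreeGroup α →* FreeGroup β) (hf : Function.Surjective f) :
    Finite β ∧ Nat.card β ≤ Nat.card α := by
  let Z := Multiplicative (ZMod 2)
  have : Finite Z := inferInstanceAs (Finite (ZMod 2))
  have hinj : Function.Injective
      fun (c : β → Z) (a : α) => FreeGroup.lift c (f (FreeGroup.of a)) := by
    intro c d hcd
    apply FreeGroup.lift.injective
    rw [← MonoidHom.cancel_right hf]
    exact FreeGroup.ext_hom _ _ fun a => congrFun hcd a
  have hfin : Finite (β → Z) := Finite.of_injective _ hinj
  have hβ : Finite β := by
    by_contra h
    rw [not_finite_iff_infinite] at h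
    have : Nontrivial Z := inferInstanceAs (Nontrivial (ZMod 2))
    exact not_finite (β → Z)
  refine ⟨hβ, ?_⟩
  have hcard := Nat.card_le_card_of_injective _ hinj
  have hZ : Nat.card Z = 2 := Nat.card_zmod 2
  rw [Nat.card_fun, Nat.card_fun, hZ] at hcard
  exact (Nat.pow_le_pow_iff_right (by norm_num)).mp hcard

theorem Group.FG.exists_freeGroup_surjective (G : Type*) [Group G] [Group.FG G] :
    ∃ (n : ℕ) (f : FreeGroup (Fin n) →* G), Function.Surjective f := by
  obtain ⟨S, hS⟩ := Group.FG.out (G := G)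
  refine ⟨S.card, FreeGroup.lift fun i => (S.equivFin.symm i : G), ?_⟩
  rw [← MonoidHom.range_eq_top, eq_top_iff, ← hS, Subgroup.closure_le]
  intro s hs
  exact ⟨FreeGroup.of (S.equivFin ⟨s, hs⟩), by simp⟩

theorem bddAbove_setOf_surjective_freeGroup (G : Type*) [Group G] [Group.FG G] :
    BddAbove {r : ℕ | ∃ φ : G →* FreeGroup (Fin r), Function.Surjective φ} := by
  obtain ⟨n, f, hf⟩ := Group.FG.exists_freeGroup_surjective G
  refine ⟨n, ?_⟩
  rintro r ⟨φ, hφ⟩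
  simpa using (FreeGroup.finite_and_card_le_of_surjective (φ.comp f) (hφ.comp hf)).2

theorem exists_surjective_corank (G : Type*) [Group G] [Group.FG G] :
    ∃ φ : G →* FreeGroup (Fin (corank G)), Function.Surjective φ :=
  Nat.sSup_mem (s := {r : ℕ | ∃ φ : G →* FreeGroup (Fin r), Function.Surjective φ})
    ⟨0, 1, fun _ => ⟨1, Subsingleton.elim _ _⟩⟩ (bddAbove_setOf_surjective_freeGroup G)

theorem card_le_corank {G X : Type*} [Group G] [Group.FG G] [Finite X]
    (φ : G →* FreeGroup X) (hφ : Function.Surjective φ) : Nat.card X ≤ corank G :=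
  le_csSup (bddAbove_setOf_surjective_freeGroup G)
    ⟨(FreeGroup.freeGroupCongr (Finite.equivFin X)).toMonoidHom.comp φ,
      (FreeGroup.freeGroupCongr (Finite.equivFin X)).surjective.comp hφ⟩

/-- The image of a finitely generated group in a free group is free of finite rank, at most the
corank. -/
theorem exists_mulEquiv_range_card_le_corank {G F : Type*} [Group G] [Group.FG G] [Group F]
    [IsFreeGroup F] (φ : G →* F) :
    ∃ n ≤ corank G, Nonempty (FreeGroup (Fin n) ≃* φ.range) := by
  let e := IsFreeGroup.toFreeGroup φ.range
  have he : Function.Surjective (e.toMonoidHom.comp φ.rangeRestrict) :=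
    e.surjective.comp φ.rangeRestrict_surjective
  obtain ⟨m, f, hf⟩ := Group.FG.exists_freeGroup_surjective G
  have hfin := (FreeGroup.finite_and_card_le_of_surjective
    ((e.toMonoidHom.comp φ.rangeRestrict).comp f) (he.comp hf)).1
  exact ⟨_, card_le_corank _ he,
    ⟨(FreeGroup.freeGroupCongr (Finite.equivFin _)).symm.trans e.symm⟩⟩

theorem Monoid.Coprod.group_fg (G H : Type*) [Group G] [Group H] [Group.FG G] [Group.FG H] :
    Group.FG (Monoid.Coprod G H) := by
  rw [Group.fg_def, ← range_inl_sup_range_inr]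
  refine Subgroup.FG.sup ?_ ?_ <;> rw [← Group.fg_iff_subgroup_fg] <;>
    exact Group.fg_range _

/-- For finitely generated groups `G` and `H`,
`corank (G * H) = corank G + corank H`, where `G * H` is the free product. -/
theorem corank_coprod (G H : Type*) [Group G] [Group H] [Group.FG G] [Group.FG H] :
    corank (Monoid.Coprod G H) = corank G + corank H := by
  have := Monoid.Coprod.group_fg G H
  apply le_antisymm
  · obtain ⟨φ, hφ⟩ := exists_surjective_corank (Monoid.Coprod G H)
    obtain ⟨a, ha, ⟨eA⟩⟩ := exists_mulEquiv_range_card_le_corank (φ.comp Monoid.Coprod.inl)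
    obtain ⟨b, hb, ⟨eB⟩⟩ := exists_mulEquiv_range_card_le_corank (φ.comp Monoid.Coprod.inr)
    let fA := (Subgroup.subtype _).comp eA.toMonoidHom
    let fB := (Subgroup.subtype _).comp eB.toMonoidHom
    let f : FreeGroup (Fin a ⊕ Fin b) →* FreeGroup (Fin (corank (Monoid.Coprod G H))) :=
      FreeGroup.lift (Sum.elim (fA ∘ FreeGroup.of) (fB ∘ FreeGroup.of))
    have hfA : f.comp (FreeGroup.map Sum.inl) = fA := by ext; simp [f]
    have hfB : f.comp (FreeGroup.map Sum.inr) = fB := by ext; simp [f]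
    have hf : Function.Surjective f := by
      rw [← MonoidHom.range_eq_top, eq_top_iff, ← MonoidHom.range_eq_top.mpr hφ,
        Monoid.Coprod.range_eq, sup_le_iff]
      constructor
      · intro x hx
        refine ⟨FreeGroup.map Sum.inl (eA.symm ⟨x, hx⟩), ?_⟩
        rw [← MonoidHom.comp_apply, hfA]
        simp [fA]
      · intro x hx
        refine ⟨FreeGroup.map Sum.inr (eB.symm ⟨x, hx⟩), ?_⟩
        rw [← MonoidHom.comp_apply, hfB]
        simp [fB]
    have hcard := (FreeGroup.finite_and_card_le_of_surjective f hf).2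
    simp only [Nat.card_sum, Nat.card_fin] at hcard
    exact hcard.trans (add_le_add ha hb)
  · obtain ⟨φ, hφ⟩ := exists_surjective_corank G
    obtain ⟨ψ, hψ⟩ := exists_surjective_corank H
    let f : Monoid.Coprod G H →* FreeGroup (Fin (corank G) ⊕ Fin (corank H)) :=
      Monoid.Coprod.lift ((FreeGroup.map Sum.inl).comp φ) ((FreeGroup.map Sum.inr).comp ψ)
    have hf : Function.Surjective f := by
      rw [← MonoidHom.range_eq_top, eq_top_iff, ← FreeGroup.closure_range_of,
        Subgroup.closure_le]
      rintro _ ⟨i | i, rfl⟩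
      · obtain ⟨g, hg⟩ := hφ (FreeGroup.of i)
        exact ⟨Monoid.Coprod.inl g, by simp [f, hg]⟩
      · obtain ⟨h, hh⟩ := hψ (FreeGroup.of i)
        exact ⟨Monoid.Coprod.inr h, by simp [f, hh]⟩
    simpa using card_le_corank f hf
end

section
/- The automorphism group Aut(F_r) of a finitely generated free group F_r is generated by the elementary Nielsen transformations: permutations of the generators, inversion of a single generator, and replacement of one generator a_i by a_i a_j for i ≠ j. -/
/-- An automorphism of the free group `F_r` is an elementary Nielsen transformation if it
permutes the generators, inverts one generator fixing the others, or replaces one generator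
`a_i` by `a_i * a_j` (`i ≠ j`) fixing the others. -/
def IsElementaryNielsen {r : ℕ} (φ : MulAut (FreeGroup (Fin r))) : Prop :=
  (∃ σ : Equiv.Perm (Fin r), ∀ k, φ (FreeGroup.of k) = FreeGroup.of (σ k)) ∨
  (∃ i, φ (FreeGroup.of i) = (FreeGroup.of i)⁻¹ ∧
    ∀ j ≠ i, φ (FreeGroup.of j) = FreeGroup.of j) ∨
  (∃ i j, i ≠ j ∧ φ (FreeGroup.of i) = FreeGroup.of i * FreeGroup.of j ∧
    ∀ k ≠ i, φ (FreeGroup.of k) = FreeGroup.of k)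

namespace List

variable {α : Type*} [DecidableEq α]

/-- The length of the longest common prefix of two lists. -/
def commonPrefixLength : List α → List α → ℕ
  | a :: l, b :: m => if a = b then commonPrefixLength l m + 1 else 0
  | _, _ => 0

theorem commonPrefixLength_comm (l m : List α) :
    commonPrefixLength l m = commonPrefixLength m l := by
  induction l generalizing m with
  | nil => cases m <;> simp [commonPrefixLength]
  | cons a l ih => cases m <;> simp [commonPrefixLength, eq_comm, ih]

theorem min_commonPrefixLength_le (l m n : List α) :
    min (commonPrefixLength l m) (commonPrefixLength m n) ≤ commonPrefixLength l n := by
  induction l generalizing m n with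
  | nil => cases m <;> simp [commonPrefixLength]
  | cons a l ih =>
    cases m with
    | nil => simp [commonPrefixLength]
    | cons b m =>
      cases n with
      | nil => simp [commonPrefixLength]
      | cons c n =>
        have := ih m n
        simp only [commonPrefixLength]
        split_ifs <;> first | omega | simp_all

theorem exists_commonPrefix (l m : List α) :
    ∃ p l' m', l = p ++ l' ∧ m = p ++ m' ∧ p.length = commonPrefixLength l m ∧
      ∀ x ∈ l'.head?, ∀ y ∈ m'.head?, x ≠ y := by
  induction l generalizing m with
  | nil => exact ⟨[], [], m, by simp [commonPrefixLength]⟩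
  | cons a l ih =>
    cases m with
    | nil => exact ⟨[], a :: l, [], by simp [commonPrefixLength]⟩
    | cons b m =>
      by_cases hab : a = b
      · obtain ⟨p, l', m', rfl, rfl, hp, h⟩ := ih m
        exact ⟨a :: p, l', m', by simp [hab], by simp [hab], by simp [commonPrefixLength, hab, hp], h⟩
      · exact ⟨[], a :: l, b :: m, by simp [commonPrefixLength, hab]⟩

end List

namespace FreeGroup

section Gromov

variable {α : Type*}

theorem IsReduced.invRev {L : List (α × Bool)} (h : IsReduced L) : IsReduced (invRev L) := by
  classical
  rw [isReduced_iff_reduce_eq] at h ⊢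
  rw [reduce_invRev, h]

theorem IsReduced.invRev_append {A B : List (α × Bool)} (hA : IsReduced A) (hB : IsReduced B)
    (h : ∀ x ∈ A.head?, ∀ y ∈ B.head?, x ≠ y) : IsReduced (FreeGroup.invRev A ++ B) := by
  refine List.IsChain.append hA.invRev hB ?_
  rintro ⟨x, b⟩ hx ⟨y, c⟩ hy hxy
  cases A with
  | nil => simp at hx
  | cons z A =>
    rw [invRev_cons] at hx
    simp [FreeGroup.invRev] at hx
    have hne := h z (by simp) _ hy
    obtain ⟨rfl, hz⟩ := hx
    have hyz : z.2 ≠ c := fun hc => hne (Prod.ext hxy hc)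
    change b = c
    revert hz hyz
    cases z.2 <;> cases b <;> cases c <;> simp

variable [DecidableEq α]

/-- The Gromov product based at `1` of two elements of a free group, for the word metric. -/
def gromovProduct (g h : FreeGroup α) : ℕ := List.commonPrefixLength g.toWord h.toWord

theorem gromovProduct_comm (g h : FreeGroup α) : gromovProduct g h = gromovProduct h g :=
  List.commonPrefixLength_comm _ _

theorem min_gromovProduct_le (f g h : FreeGroup α) :
    min (gromovProduct f g) (gromovProduct g h) ≤ gromovProduct f h :=
  List.min_commonPrefixLength_le _ _ _

theorem exists_toWord_inv_mul (g h : FreeGroup α) :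
    ∃ L A B, g.toWord = L ++ A ∧ h.toWord = L ++ B ∧ L.length = gromovProduct g h ∧
      (g⁻¹ * h).toWord = invRev A ++ B := by
  obtain ⟨L, A, B, hA, hB, hL, hne⟩ := List.exists_commonPrefix g.toWord h.toWord
  refine ⟨L, A, B, hA, hB, hL, ?_⟩
  have hgr : IsReduced (L ++ A) := hA ▸ isReduced_toWord
  have hhr : IsReduced (L ++ B) := hB ▸ isReduced_toWord
  have hred : IsReduced (invRev A ++ B) :=
    IsReduced.invRev_append hgr.right_of_append hhr.right_of_append hne
  have hg : g = mk L * mk A := by rw [mul_mk, ← hA, mk_toWord]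
  have hh : h = mk L * mk B := by rw [mul_mk, ← hB, mk_toWord]
  have : g⁻¹ * h = mk (invRev A ++ B) := by
    rw [hg, hh, ← mul_mk, ← inv_mk]
    group
  rw [this, toWord_mk, hred.reduce_eq]

theorem norm_inv_mul_add (g h : FreeGroup α) :
    norm (g⁻¹ * h) + 2 * gromovProduct g h = norm g + norm h := by
  obtain ⟨L, A, B, hA, hB, hL, hw⟩ := exists_toWord_inv_mul g h
  rw [norm, norm, norm, hw, hA, hB, ← hL]
  simp only [List.length_append, invRev_length]
  omega

theorem norm_mul_add (g h : FreeGroup α) :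
    norm (g * h) + 2 * gromovProduct g⁻¹ h = norm g + norm h := by
  simpa using norm_inv_mul_add g⁻¹ h

theorem two_mul_gromovProduct_inv_self_lt {g : FreeGroup α} (hg : g ≠ 1) :
    2 * gromovProduct g⁻¹ g < norm g := by
  by_contra! hle
  obtain ⟨L, A, B, hA, hB, hL, -⟩ := exists_toWord_inv_mul g⁻¹ g
  rw [← hL] at hle
  have hpos : 0 < norm g := Nat.pos_of_ne_zero (by simpa using hg)
  rw [norm] at hle hpos
  set w := g.toWord with hw
  have hred : IsReduced w := isReduced_toWord
  rw [toWord_inv, ← hw] at hA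
  have key : ∀ i (hi : i < L.length) (hi' : i < w.length),
      w[i] = (w[w.length - 1 - i].1, !w[w.length - 1 - i].2) := by
    intro i hi hi'
    have h1 : (invRev w)[i]? = w[i]? := by
      rw [hA, hB, List.getElem?_append_left hi, List.getElem?_append_left hi]
    have h2 : (invRev w)[i]? = some (w[w.length - 1 - i].1, !w[w.length - 1 - i].2) := by
      rw [List.getElem?_eq_getElem (by simpa using hi')]
      simp [invRev]
    rw [h2, List.getElem?_eq_getElem hi'] at h1
    exact (Option.some.inj h1).symm
  have hlt : (w.length - 1) / 2 < w.length := by omega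
  have hk := key ((w.length - 1) / 2) (by omega) hlt
  obtain h | h : w.length - 1 - (w.length - 1) / 2 = (w.length - 1) / 2 ∨
      w.length - 1 - (w.length - 1) / 2 = (w.length - 1) / 2 + 1 := by omega
  · simp only [h] at hk
    have := congrArg Prod.snd hk
    simp at this
  · simp only [h] at hk
    have hc := List.isChain_iff_getElem.1 hred ((w.length - 1) / 2) (by omega)
    rw [hk] at hc
    simp at hc

end Gromov

section Measure

variable {r : ℕ}

/-- A numerical encoding of words, strictly monotone under replacement of a prefix by a prefix of
the same length and larger value. -/
def wordValue (L : List (Fin r × Bool)) : ℕ :=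
  Nat.ofDigits (2 * r + 2) (L.map fun x => 2 * x.1.val + x.2.toNat).reverse

theorem wordValue_append (P R : List (Fin r × Bool)) :
    wordValue (P ++ R) = wordValue R + (2 * r + 2) ^ R.length * wordValue P := by
  simp [wordValue, Nat.ofDigits_append]

theorem eq_of_wordValue_eq {P Q : List (Fin r × Bool)} (hl : P.length = Q.length)
    (h : wordValue P = wordValue Q) : P = Q := by
  have hb : ∀ (L : List (Fin r × Bool)),
      ∀ l ∈ (L.map fun x => 2 * x.1.val + x.2.toNat).reverse, l < 2 * r + 2 := by
    intro L l hl
    simp only [List.mem_reverse, List.mem_map] at hl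
    obtain ⟨⟨i, b⟩, -, rfl⟩ := hl
    have := i.2
    have := Bool.toNat_le b
    simp only
    omega
  have := Nat.ofDigits_inj_of_len_eq (by omega) (by simpa using hl) (hb P) (hb Q) h
  refine List.map_injective_iff.2 ?_ (List.reverse_injective this)
  rintro ⟨i, b⟩ ⟨j, c⟩ hij
  cases b <;> cases c <;> simp [Fin.ext_iff] at hij ⊢ <;> omega

/-- The value of the first half of the reduced word of `g`. -/
def halfValue (g : FreeGroup (Fin r)) : ℕ := wordValue (g.toWord.take (norm g / 2))

/-- The complexity of an element: its length, with ties broken by the values of the initial halves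
of the element and of its inverse. -/
def complexity (g : FreeGroup (Fin r)) : ℕ ×ₗ ℕ :=
  toLex (norm g, halfValue g + halfValue g⁻¹)

theorem complexity_inv (g : FreeGroup (Fin r)) : complexity g⁻¹ = complexity g := by
  simp [complexity, add_comm]

theorem complexity_lt_of_norm_lt {g h : FreeGroup (Fin r)} (hlt : norm g < norm h) :
    complexity g < complexity h :=
  Prod.Lex.toLex_lt_toLex.2 (.inl hlt)

theorem complexity_mul_lt {b c : FreeGroup (Fin r)} {P Q C : List (Fin r × Bool)}
    (hc : c.toWord = Q ++ C) (hbc : (b * c).toWord = P ++ C) (hPQ : P.length = Q.length)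
    (hQC : Q.length ≤ C.length) (hlt : wordValue P < wordValue Q) :
    complexity (b * c) < complexity c := by
  have hn : norm (b * c) = norm c := by simp [norm, hc, hbc, hPQ]
  have hnc : norm c = Q.length + C.length := by simp [norm, hc]
  refine Prod.Lex.toLex_lt_toLex.2 (.inr ⟨hn, ?_⟩)
  simp only [halfValue, norm_inv_eq, hn, toWord_inv, hc, hbc, invRev_append]
  have hinv : ∀ R : List (Fin r × Bool),
      (invRev C ++ R).take (norm c / 2) = (invRev C).take (norm c / 2) :=
    fun R => List.take_append_of_le_length (by rw [invRev_length]; omega)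
  rw [hinv, hinv, List.take_append, List.take_append, List.take_of_length_le (l := P) (by omega),
    List.take_of_length_le (l := Q) (by omega), hPQ, wordValue_append, wordValue_append]
  gcongr

/-- In the case of a tie, one of the two neighbours of `b` can be simplified. -/
theorem complexity_mul_lt_or {a b c : FreeGroup (Fin r)} (hb1 : b ≠ 1)
    (hab : 2 * gromovProduct a⁻¹ b = norm b) (hbc : 2 * gromovProduct b⁻¹ c = norm b)
    (ha : norm b ≤ norm a) (hc : norm b ≤ norm c) :
    complexity (b * c) < complexity c ∨ complexity (b⁻¹ * a⁻¹) < complexity a⁻¹ := by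
  obtain ⟨P, B, A, hP, hA, hPl, hPw⟩ := exists_toWord_inv_mul b a⁻¹
  obtain ⟨Q, B', C, hQ, hC, hQl, hQw⟩ := exists_toWord_inv_mul b⁻¹ c
  rw [gromovProduct_comm] at hPl
  have hPB : norm b = P.length + B.length := by simp [norm, hP]
  have hQC : norm c = Q.length + C.length := by simp [norm, hC]
  have hPA : norm a = P.length + A.length := by rw [← norm_inv_eq]; simp [norm, hA]
  rw [toWord_inv, hP, invRev_append] at hQ
  obtain ⟨rfl, rfl⟩ := List.append_inj hQ (by simp; omega)
  rw [invRev_invRev, inv_inv] at hQw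
  simp only [invRev_length] at *
  rcases lt_trichotomy (wordValue P) (wordValue (invRev B)) with h | h | h
  · exact .inl (complexity_mul_lt hC hQw (by simp; omega) (by simp; omega) h)
  · exfalso
    have hPeq := eq_of_wordValue_eq (by simp; omega) h
    apply hb1
    have h1 : b⁻¹ = b := by
      apply toWord_injective
      rw [toWord_inv, hP, invRev_append, ← hPeq, hPeq, invRev_invRev]
    have := two_mul_gromovProduct_inv_self_lt hb1
    rw [h1] at this hbc
    have h2 := norm_inv_mul_add b b
    rw [inv_mul_cancel, norm_one] at h2
    omega
  · exact .inr (complexity_mul_lt hA hPw (by simp; omega) (by omega) h)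

end Measure

section Reduced

variable {r : ℕ}

/-- The Nielsen condition: no letter is more than half-cancelled from both sides together. -/
def IsNielsenReduced (β : MulAut (FreeGroup (Fin r))) : Prop :=
  ∀ x y z : Fin r × Bool, IsReduced [x, y, z] →
    gromovProduct (β (mk [x]))⁻¹ (β (mk [y])) + gromovProduct (β (mk [y]))⁻¹ (β (mk [z])) <
      norm (β (mk [y]))

theorem mk_singleton_ne_one {α : Type*} (x : α × Bool) : (mk [x] : FreeGroup α) ≠ 1 := by
  classical
  rw [Ne, ← toWord_eq_nil_iff, toWord_mk, reduce_singleton]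
  simp

theorem mk_not {α : Type*} (i : α) (b : Bool) : (mk [(i, !b)] : FreeGroup α) = (mk [(i, b)])⁻¹ := by
  simp [inv_mk, invRev]

theorem isNielsenReduced_of_forall_le {β : MulAut (FreeGroup (Fin r))}
    (h : ∀ x y : Fin r × Bool, x.1 ≠ y.1 →
      complexity (β (mk [x])) ≤ complexity (β (mk [x]) * β (mk [y]))) : IsNielsenReduced β := by
  have hne : ∀ x, β (mk [x]) ≠ 1 := fun x => by
    rw [Ne, EmbeddingLike.map_eq_one_iff]
    exact mk_singleton_ne_one x
  have h' : ∀ x y : Fin r × Bool, x.1 ≠ y.1 →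
      complexity (β (mk [y])) ≤ complexity (β (mk [x]) * β (mk [y])) := by
    rintro ⟨i, b⟩ ⟨j, c⟩ hij
    have := h (j, !c) (i, !b) hij.symm
    rwa [mk_not, mk_not, _root_.map_inv, _root_.map_inv, ← mul_inv_rev, complexity_inv,
      complexity_inv] at this
  have hnorm : ∀ x y : Fin r × Bool, x.1 ≠ y.1 →
      2 * gromovProduct (β (mk [x]))⁻¹ (β (mk [y])) ≤ norm (β (mk [x])) ∧
      2 * gromovProduct (β (mk [x]))⁻¹ (β (mk [y])) ≤ norm (β (mk [y])) := by
    intro x y hxy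
    have h1 := norm_mul_add (β (mk [x])) (β (mk [y]))
    have h2 := not_lt.1 (mt complexity_lt_of_norm_lt (h x y hxy).not_gt)
    have h3 := not_lt.1 (mt complexity_lt_of_norm_lt (h' x y hxy).not_gt)
    omega
  have hhalf : ∀ x y : Fin r × Bool, (x.1 = y.1 → x.2 = y.2) →
      (2 * gromovProduct (β (mk [x]))⁻¹ (β (mk [y])) < norm (β (mk [x])) ∧
      2 * gromovProduct (β (mk [x]))⁻¹ (β (mk [y])) < norm (β (mk [y]))) ∨ (x.1 ≠ y.1 ∧
      2 * gromovProduct (β (mk [x]))⁻¹ (β (mk [y])) ≤ norm (β (mk [x])) ∧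
      2 * gromovProduct (β (mk [x]))⁻¹ (β (mk [y])) ≤ norm (β (mk [y]))) := by
    intro x y hxy
    by_cases hi : x.1 = y.1
    · obtain rfl : x = y := Prod.ext hi (hxy hi)
      have := two_mul_gromovProduct_inv_self_lt (hne x)
      exact .inl ⟨this, this⟩
    · exact .inr ⟨hi, hnorm x y hi⟩
  intro x y z hxyz
  simp only [isReduced_cons_cons] at hxyz
  obtain ⟨hxy, hyz, -⟩ := hxyz
  by_contra! hle
  have h1 := hhalf x y hxy
  have h2 := hhalf y z hyz
  have hx : x.1 ≠ y.1 := by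
    intro hi
    have : ¬ x.1 ≠ y.1 := by simpa using hi
    omega
  have hz : y.1 ≠ z.1 := by
    intro hi
    have : ¬ y.1 ≠ z.1 := by simpa using hi
    omega
  rcases complexity_mul_lt_or (a := β (mk [x])) (c := β (mk [z])) (hne y)
    (by omega) (by omega) (by omega) (by omega) with h3 | h3
  · exact h3.not_ge (h' y z hz)
  · rw [← mul_inv_rev, complexity_inv, complexity_inv] at h3
    exact h3.not_ge (h x y hx)

theorem IsNielsenReduced.gromovProduct_eq {β : MulAut (FreeGroup (Fin r))}
    (h : IsNielsenReduced β) (L : List (Fin r × Bool)) (z x : Fin r × Bool)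
    (hred : IsReduced (z :: x :: L)) :
    gromovProduct (β (mk [z]))⁻¹ (β (mk (x :: L))) =
      gromovProduct (β (mk [z]))⁻¹ (β (mk [x])) ∧
    L.length + 1 + gromovProduct (β (mk [z]))⁻¹ (β (mk [x])) ≤ norm (β (mk (x :: L))) := by
  induction L generalizing z x with
  | nil =>
    have := h z x x (by simp_all [isReduced_cons_cons])
    simp only [List.length_nil, true_and]
    omega
  | cons y L ih =>
    simp only [isReduced_cons_cons] at hred
    obtain ⟨hzx, hxy, hyL⟩ := hred
    obtain ⟨ih1, ih2⟩ := ih x y (isReduced_cons_cons.2 ⟨hxy, hyL⟩)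
    have hlt := h z x y
      (isReduced_cons_cons.2 ⟨hzx, isReduced_cons_cons.2 ⟨hxy, .singleton⟩⟩)
    have hmul : β (mk (x :: y :: L)) = β (mk [x]) * β (mk (y :: L)) := by
      rw [← _root_.map_mul, mul_mk]; rfl
    set g := β (mk (x :: y :: L))
    have hg' : β (mk (y :: L)) = (β (mk [x]))⁻¹ * g := by rw [hmul]; group
    have e1 := norm_mul_add (β (mk [x])) (β (mk (y :: L)))
    rw [← hmul, ih1] at e1
    have e2 := norm_inv_mul_add (β (mk [x])) g
    rw [← hg'] at e2
    have u1 := min_gromovProduct_le (β (mk [z]))⁻¹ (β (mk [x])) g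
    have u2 := min_gromovProduct_le (β (mk [z]))⁻¹ g (β (mk [x]))
    rw [gromovProduct_comm g] at u2
    simp only [List.length_cons]
    constructor <;> omega

theorem IsNielsenReduced.exists_letter {β : MulAut (FreeGroup (Fin r))}
    (h : IsNielsenReduced β) (i : Fin r) : ∃ x, β (mk [x]) = of i := by
  have hw : mk (β.symm (of i)).toWord = β.symm (of i) := mk_toWord
  have hred : IsReduced (β.symm (of i)).toWord := isReduced_toWord
  generalize (β.symm (of i)).toWord = w at hw hred
  have hβ : β (mk w) = of i := by rw [hw]; exact β.apply_symm_apply _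
  match w with
  | [] =>
    rw [← one_eq_mk, _root_.map_one] at hβ
    exact absurd hβ.symm (of_ne_one i)
  | [x] => exact ⟨x, hβ⟩
  | x :: y :: L =>
    have := (h.gromovProduct_eq (y :: L) x x (isReduced_cons_cons.2 ⟨fun _ => rfl, hred⟩)).2
    rw [hβ, norm_of] at this
    simp only [List.length_cons] at this
    omega

end Reduced

section Generators

variable {r : ℕ}

/-- The subgroup of `Aut(F_r)` generated by the elementary Nielsen transformations. -/
def nielsenSubgroup (r : ℕ) : Subgroup (MulAut (FreeGroup (Fin r))) :=
  Subgroup.closure {φ | IsElementaryNielsen φ}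

theorem exists_mem_nielsenSubgroup_perm (σ : Equiv.Perm (Fin r)) :
    ∃ φ ∈ nielsenSubgroup r, ∀ k, φ (of k) = of (σ k) :=
  ⟨freeGroupCongr σ, Subgroup.subset_closure (.inl ⟨σ, fun k => by simp⟩), fun k => by simp⟩

theorem exists_mem_nielsenSubgroup_inv (i : Fin r) :
    ∃ φ ∈ nielsenSubgroup r, φ (of i) = (of i)⁻¹ ∧ ∀ j ≠ i, φ (of j) = of j := by
  let f : FreeGroup (Fin r) →* FreeGroup (Fin r) :=
    lift fun k => if k = i then (of k)⁻¹ else of k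
  have hf : f.comp f = MonoidHom.id _ := by
    ext k
    by_cases hk : k = i <;> simp [f, hk]
  let φ : MulAut (FreeGroup (Fin r)) := MonoidHom.toMulEquiv f f hf hf
  have h1 : φ (of i) = (of i)⁻¹ := by simp [φ, f]
  have h2 : ∀ j ≠ i, φ (of j) = of j := fun j hj => by simp [φ, f, hj]
  exact ⟨φ, Subgroup.subset_closure (.inr (.inl ⟨i, h1, h2⟩)), h1, h2⟩

theorem exists_mem_nielsenSubgroup_mul {i j : Fin r} (hij : i ≠ j) (b : Bool) :
    ∃ φ ∈ nielsenSubgroup r, φ (of i) = of i * mk [(j, b)] ∧ ∀ k ≠ i, φ (of k) = of k := by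
  let f : Bool → FreeGroup (Fin r) →* FreeGroup (Fin r) := fun b =>
    lift fun k => if k = i then of k * mk [(j, b)] else of k
  have hfj : ∀ b c, f b (mk [(j, c)]) = mk [(j, c)] := by
    intro b c
    cases c <;> simp [f, hij.symm, of, inv_mk, invRev]
  have hf : ∀ b, (f b).comp (f !b) = MonoidHom.id _ := by
    intro b
    ext k
    by_cases hk : k = i
    · have : (f !b) (of k) = of k * mk [(j, !b)] := by simp [f, hk]
      have hk' : f b (of k) = of k * mk [(j, b)] := by simp [f, hk]
      rw [MonoidHom.comp_apply, this, _root_.map_mul, hfj, hk', mk_not, mul_inv_cancel_right]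
      rfl
    · simp [f, hk]
  let φ : MulAut (FreeGroup (Fin r)) := MonoidHom.toMulEquiv (f true) (f false) (hf false) (hf true)
  have h1 : φ (of i) = of i * of j := by simp [φ, f]; rfl
  have h2 : ∀ k ≠ i, φ (of k) = of k := fun k hk => by simp [φ, f, hk]
  have hφ : φ ∈ nielsenSubgroup r :=
    Subgroup.subset_closure (.inr (.inr ⟨i, j, hij, h1, h2⟩))
  cases b with
  | true => exact ⟨φ, hφ, h1, h2⟩
  | false =>
    refine ⟨φ⁻¹, inv_mem hφ, ?_, fun k hk => ?_⟩
    · change f false (of i) = _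
      simp [f]
    · change f false (of k) = _
      simp [f, hk]

theorem exists_mem_nielsenSubgroup_mul_letter {x y : Fin r × Bool} (hxy : x.1 ≠ y.1) :
    ∃ φ ∈ nielsenSubgroup r, φ (of x.1) = mk [x] * mk [y] ∧ ∀ k ≠ x.1, φ (of k) = of k := by
  obtain ⟨φ, hφ, h1, h2⟩ := exists_mem_nielsenSubgroup_mul hxy y.2
  obtain ⟨i, b⟩ := x
  cases b with
  | true => exact ⟨φ, hφ, h1, h2⟩
  | false =>
    obtain ⟨ψ, hψ, h3, h4⟩ := exists_mem_nielsenSubgroup_inv i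
    have hy : ψ (mk [y]) = mk [y] := by
      obtain ⟨j, c⟩ := y
      have hj : ψ (mk [(j, true)]) = mk [(j, true)] := h4 j hxy.symm
      cases c with
      | true => exact hj
      | false => rw [← Bool.not_true, mk_not, _root_.map_inv, hj]
    refine ⟨ψ * φ, mul_mem hψ hφ, ?_, fun k hk => ?_⟩
    · rw [MulAut.mul_apply, h1, _root_.map_mul, h3, hy, ← Bool.not_true, mk_not]
      rfl
    · rw [MulAut.mul_apply, h2 k hk, h4 k hk]

theorem exists_mem_nielsenSubgroup_inv_finset (s : Finset (Fin r)) :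
    ∃ φ ∈ nielsenSubgroup r, ∀ k, φ (of k) = if k ∈ s then (of k)⁻¹ else of k := by
  induction s using Finset.induction_on with
  | empty => exact ⟨1, one_mem _, fun k => by simp⟩
  | insert i s hi ih =>
    obtain ⟨φ, hφ, h⟩ := ih
    obtain ⟨ψ, hψ, h1, h2⟩ := exists_mem_nielsenSubgroup_inv i
    refine ⟨φ * ψ, mul_mem hφ hψ, fun k => ?_⟩
    rw [MulAut.mul_apply]
    by_cases hk : k = i
    · subst hk
      simp [h1, h, hi]
    · simp [h2 k hk, h, hk]

theorem mem_nielsenSubgroup_of_forall_letter {β : MulAut (FreeGroup (Fin r))}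
    (h : ∀ i, ∃ x, β (mk [x]) = of i) : β ∈ nielsenSubgroup r := by
  choose x hx using h
  have hsign : ∀ (k : Fin r) (c : Bool), (mk [(k, c)] : FreeGroup (Fin r)) =
      if c = false then (of k)⁻¹ else of k := by
    intro k c
    cases c
    · rw [← Bool.not_true, mk_not]; rfl
    · rfl
  have hinj : Function.Injective fun i => (x i).1 := by
    intro i j hij
    simp only at hij
    have hxy : x i = x j ∨ x i = ((x j).1, !(x j).2) := by
      rw [Prod.ext_iff, Prod.ext_iff]
      cases (x i).2 <;> cases (x j).2 <;> simp [hij]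
    rcases hxy with h | h
    · exact of_injective (by rw [← hx i, ← hx j, h])
    · have h1 : of i = (of j)⁻¹ := by rw [← hx i, ← hx j, h, mk_not, _root_.map_inv]
      have h2 := congrArg toWord h1
      simp [toWord_inv, invRev] at h2
  let σ : Equiv.Perm (Fin r) := Equiv.ofBijective _ (Finite.injective_iff_bijective.1 hinj)
  obtain ⟨φ, hφ, h1⟩ := exists_mem_nielsenSubgroup_perm σ
  obtain ⟨ψ, hψ, h2⟩ := exists_mem_nielsenSubgroup_inv_finset
    (Finset.univ.filter fun i => (x i).2 = false)
  have hinv : β * (φ * ψ) = 1 := by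
    refine MulEquiv.toMonoidHom_injective (FreeGroup.ext_hom _ _ fun i => ?_)
    change β (φ (ψ (of i))) = of i
    rw [h2]
    refine (congrArg β ?_).trans (hx i)
    rw [← Prod.mk.eta (p := x i), hsign]
    simp only [Finset.mem_filter, Finset.mem_univ, true_and]
    split_ifs
    · rw [_root_.map_inv, h1]; rfl
    · rw [h1]; rfl
  rw [eq_inv_of_mul_eq_one_left hinv]
  exact inv_mem (mul_mem hφ hψ)

end Generators

end FreeGroup

open FreeGroup in
/-- `Aut(F_r)` is generated by the elementary Nielsen transformations. -/
theorem aut_freeGroup_generated_by_nielsen (r : ℕ) :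
    Subgroup.closure {φ : MulAut (FreeGroup (Fin r)) | IsElementaryNielsen φ} = ⊤ := by
  rw [eq_top_iff]
  intro α _
  change α ∈ nielsenSubgroup r
  let μ : MulAut (FreeGroup (Fin r)) → ℕ ×ₗ ℕ := fun β => ∑ i, complexity (β (of i))
  obtain ⟨ν, hν, hmin⟩ := exists_minimalFor_of_wellFoundedLT (· ∈ nielsenSubgroup r)
    (fun ν => μ (α * ν)) ⟨1, one_mem _⟩
  have hred : IsNielsenReduced (α * ν) := by
    refine isNielsenReduced_of_forall_le fun x y hxy => ?_
    by_contra! hlt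
    obtain ⟨φ, hφ, h1, h2⟩ := exists_mem_nielsenSubgroup_mul_letter hxy
    have hx : complexity ((α * ν) (mk [x])) = complexity ((α * ν) (of x.1)) := by
      obtain ⟨i, b⟩ := x
      cases b
      · rw [← Bool.not_true, mk_not, _root_.map_inv, complexity_inv]; rfl
      · rfl
    have hsum : μ (α * (ν * φ)) < μ (α * ν) := by
      have heq : ∀ k, (α * (ν * φ)) (of k) = (α * ν) (φ (of k)) := fun k => rfl
      refine Finset.sum_lt_sum (fun k _ => ?_) ⟨x.1, Finset.mem_univ _, ?_⟩
      · by_cases hk : k = x.1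
        · subst hk
          rw [heq, h1, _root_.map_mul, ← hx]
          exact hlt.le
        · rw [heq, h2 k hk]
      · rw [heq, h1, _root_.map_mul, ← hx]
        exact hlt
    exact hsum.not_ge (hmin (mul_mem hν hφ) hsum.le)
  have := mul_mem (mem_nielsenSubgroup_of_forall_letter hred.exists_letter) (inv_mem hν)
  rwa [mul_inv_cancel_right] at this
end
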